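/- arXiv:2507.06591 — 7 statements merged into one kernel-verified Lean document; each statement's English description precedes it below -/
import Mathlib

section
/- Let D be a Levi-Civita connection for g and suppose X1, X2 are orthonormal with a11 = −1, a12 = 0, a22 = 1. Then at every point of U the sectional curvature K = g(R_{X1 X2}X1, X2)/(−1) satisfies K = −(c1)² + (c2)² − (X2 c1) − (X1 c2), where X_i f denotes the directional derivative of f along X_i. -/
noncomputable section

/-- Points of the plane. -/
abbrev Pt : Type := ℝ × ℝ

/-- Vector fields on (an open subset of) the plane, given as maps `ℝ² → ℝ²`. -/
abbrev VF : Type := Pt → Pt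

/-- The Lie bracket of vector fields: `[V,W](q) = DW(q)(V(q)) − DV(q)(W(q))`. -/
def vbracket (V W : VF) : VF :=
  fun q => fderiv ℝ W q (V q) - fderiv ℝ V q (W q)

/-- Directional derivative of a function `f` along the vector field `X`. -/
def dirDeriv (X : VF) (f : Pt → ℝ) : Pt → ℝ :=
  fun q => fderiv ℝ f q (X q)

/-- `g` assigns to each point of `U` a symmetric bilinear form on `ℝ²`, smoothly in the point. -/
structure SmoothSymmBilin (U : Set Pt) (g : Pt → Pt → Pt → ℝ) : Prop where
  symm : ∀ q ∈ U, ∀ v w : Pt, g q v w = g q w v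
  add_left : ∀ q ∈ U, ∀ u v w : Pt, g q (u + v) w = g q u w + g q v w
  smul_left : ∀ q ∈ U, ∀ (r : ℝ) (v w : Pt), g q (r • v) w = r * g q v w
  add_right : ∀ q ∈ U, ∀ u v w : Pt, g q u (v + w) = g q u v + g q u w
  smul_right : ∀ q ∈ U, ∀ (r : ℝ) (v w : Pt), g q v (r • w) = r * g q v w
  smooth : ∀ v w : Pt, ContDiffOn ℝ (⊤ : ℕ∞) (fun q => g q v w) U

/-- A Levi-Civita connection for `g` on `U`: it sends pairs of smooth vector fields to a
smooth vector field, is `C^∞(U)`-linear in the first argument, `ℝ`-linear in the second,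
satisfies the Leibniz rule, is torsion-free and metric-compatible. -/
structure IsLeviCivita (U : Set Pt) (g : Pt → Pt → Pt → ℝ) (D : VF → VF → VF) : Prop where
  smooth : ∀ V W : VF, ContDiffOn ℝ (⊤ : ℕ∞) V U → ContDiffOn ℝ (⊤ : ℕ∞) W U →
    ContDiffOn ℝ (⊤ : ℕ∞) (D V W) U
  add_fst : ∀ V V' W : VF, ContDiffOn ℝ (⊤ : ℕ∞) V U → ContDiffOn ℝ (⊤ : ℕ∞) V' U →
    ContDiffOn ℝ (⊤ : ℕ∞) W U → ∀ q ∈ U, D (V + V') W q = D V W q + D V' W q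
  smul_fst : ∀ (f : Pt → ℝ) (V W : VF), ContDiffOn ℝ (⊤ : ℕ∞) f U →
    ContDiffOn ℝ (⊤ : ℕ∞) V U → ContDiffOn ℝ (⊤ : ℕ∞) W U →
    ∀ q ∈ U, D (fun p => f p • V p) W q = f q • D V W q
  add_snd : ∀ V W W' : VF, ContDiffOn ℝ (⊤ : ℕ∞) V U → ContDiffOn ℝ (⊤ : ℕ∞) W U →
    ContDiffOn ℝ (⊤ : ℕ∞) W' U → ∀ q ∈ U, D V (W + W') q = D V W q + D V W' q
  smul_snd : ∀ (r : ℝ) (V W : VF), ContDiffOn ℝ (⊤ : ℕ∞) V U →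
    ContDiffOn ℝ (⊤ : ℕ∞) W U → ∀ q ∈ U, D V (r • W) q = r • D V W q
  leibniz : ∀ (f : Pt → ℝ) (V W : VF), ContDiffOn ℝ (⊤ : ℕ∞) f U →
    ContDiffOn ℝ (⊤ : ℕ∞) V U → ContDiffOn ℝ (⊤ : ℕ∞) W U →
    ∀ q ∈ U, D V (fun p => f p • W p) q = fderiv ℝ f q (V q) • W q + f q • D V W q
  torsion_free : ∀ V W : VF, ContDiffOn ℝ (⊤ : ℕ∞) V U → ContDiffOn ℝ (⊤ : ℕ∞) W U →
    ∀ q ∈ U, D V W q - D W V q = vbracket V W q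
  compat : ∀ X V W : VF, ContDiffOn ℝ (⊤ : ℕ∞) X U → ContDiffOn ℝ (⊤ : ℕ∞) V U →
    ContDiffOn ℝ (⊤ : ℕ∞) W U →
    ∀ q ∈ U, fderiv ℝ (fun p => g p (V p) (W p)) q (X q)
      = g q (D X V q) (W q) + g q (V q) (D X W q)

theorem exists_eq_smul_add_smul {v w : Pt} (h : LinearIndependent ℝ ![v, w]) (u : Pt) :
    ∃ a b : ℝ, u = a • v + b • w := by
  have hu : u ∈ Submodule.span ℝ (Set.range ![v, w]) := by
    rw [h.span_eq_top_of_card_eq_finrank (by simp)]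
    trivial
  rw [Matrix.range_cons, Matrix.range_cons, Matrix.range_empty, Set.union_empty,
    Set.singleton_union, Submodule.mem_span_pair] at hu
  obtain ⟨a, b, hab⟩ := hu
  exact ⟨a, b, hab.symm⟩

theorem fderiv_eq_zero_of_eqOn_const {U : Set Pt} (hU : IsOpen U) {f : Pt → ℝ} {c : ℝ}
    (h : ∀ q ∈ U, f q = c) {q : Pt} (hq : q ∈ U) : fderiv ℝ f q = 0 := by
  have he : f =ᶠ[nhds q] fun _ => c := Filter.eventually_of_mem (hU.mem_nhds hq) h
  rw [he.fderiv_eq, fderiv_const_apply]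

theorem contDiffOn_indicator_compl (U : Set Pt) :
    ContDiffOn ℝ (⊤ : ℕ∞) (Uᶜ.indicator fun _ => (1 : ℝ)) U :=
  (contDiffOn_const (c := (0 : ℝ))).congr fun q hq => by simp [hq]

theorem eq_add_indicator_compl_smul_sub {U : Set Pt} {V W : VF} (h : ∀ q ∈ U, V q = W q) :
    V = W + fun p => Uᶜ.indicator (fun _ => (1 : ℝ)) p • (V - W) p := by
  funext p
  by_cases hp : p ∈ U <;> simp [hp, h]

namespace IsLeviCivita

variable {U : Set Pt} {g : Pt → Pt → Pt → ℝ} {D : VF → VF → VF}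

/-- On `U`, a connection depends only on the restriction to `U` of the first argument. -/
theorem congr_fst (hD : IsLeviCivita U g D) {V V' W : VF} (hV : ContDiffOn ℝ (⊤ : ℕ∞) V U)
    (hV' : ContDiffOn ℝ (⊤ : ℕ∞) V' U) (hW : ContDiffOn ℝ (⊤ : ℕ∞) W U)
    (h : ∀ q ∈ U, V q = V' q) {q : Pt} (hq : q ∈ U) : D V W q = D V' W q := by
  have hf := contDiffOn_indicator_compl U
  have hsub : ContDiffOn ℝ (⊤ : ℕ∞) (V - V') U := hV.sub hV'
  have hsmul : ContDiffOn ℝ (⊤ : ℕ∞)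
      (fun p => Uᶜ.indicator (fun _ => (1 : ℝ)) p • (V - V') p) U := hf.smul hsub
  rw [eq_add_indicator_compl_smul_sub h,
    hD.add_fst _ _ _ hV' hsmul hW q hq,
    hD.smul_fst _ _ _ hf hsub hW q hq]
  simp [hq]

/-- On `U`, a connection depends only on the restriction to `U` of the second argument. -/
theorem congr_snd (hD : IsLeviCivita U g D) {V W W' : VF} (hV : ContDiffOn ℝ (⊤ : ℕ∞) V U)
    (hW : ContDiffOn ℝ (⊤ : ℕ∞) W U) (hW' : ContDiffOn ℝ (⊤ : ℕ∞) W' U)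
    (h : ∀ q ∈ U, W q = W' q) {q : Pt} (hq : q ∈ U) : D V W q = D V W' q := by
  have hf := contDiffOn_indicator_compl U
  have hsub : ContDiffOn ℝ (⊤ : ℕ∞) (W - W') U := hW.sub hW'
  have hsmul : ContDiffOn ℝ (⊤ : ℕ∞)
      (fun p => Uᶜ.indicator (fun _ => (1 : ℝ)) p • (W - W') p) U := hf.smul hsub
  rw [eq_add_indicator_compl_smul_sub h,
    hD.add_snd _ _ _ hV hW' hsmul q hq,
    hD.leibniz _ _ _ hf hV hsub q hq]
  simp [hq, h]

/-- The Levi-Civita connection in a Lorentzian orthonormal frame is determined by the structure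
functions of the frame. -/
theorem frame_eq (hD : IsLeviCivita U g D) (hU : IsOpen U) {X1 X2 : VF}
    (hX1 : ContDiffOn ℝ (⊤ : ℕ∞) X1 U) (hX2 : ContDiffOn ℝ (⊤ : ℕ∞) X2 U)
    (hbasis : ∀ q ∈ U, LinearIndependent ℝ ![X1 q, X2 q]) (hg : SmoothSymmBilin U g)
    (h11 : ∀ q ∈ U, g q (X1 q) (X1 q) = -1) (h22 : ∀ q ∈ U, g q (X2 q) (X2 q) = 1)
    (h12 : ∀ q ∈ U, g q (X1 q) (X2 q) = 0) {c1 c2 : Pt → ℝ}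
    (hc : ∀ q ∈ U, vbracket X1 X2 q = c1 q • X1 q + c2 q • X2 q) {q : Pt} (hq : q ∈ U) :
    D X1 X1 q = c1 q • X2 q ∧ D X2 X1 q = -c2 q • X2 q ∧ D X1 X2 q = c1 q • X1 q := by
  have h21 : g q (X2 q) (X1 q) = 0 := by rw [hg.symm q hq, h12 q hq]
  have e111 := hD.compat X1 X1 X1 hX1 hX1 hX1 q hq
  have e211 := hD.compat X2 X1 X1 hX2 hX1 hX1 q hq
  have e112 := hD.compat X1 X1 X2 hX1 hX1 hX2 q hq
  have e122 := hD.compat X1 X2 X2 hX1 hX2 hX2 q hq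
  have ht := hD.torsion_free X1 X2 hX1 hX2 q hq
  obtain ⟨a, b, hab⟩ := exists_eq_smul_add_smul (hbasis q hq) (D X1 X1 q)
  obtain ⟨a', b', hab'⟩ := exists_eq_smul_add_smul (hbasis q hq) (D X2 X1 q)
  obtain ⟨d, e, hde⟩ := exists_eq_smul_add_smul (hbasis q hq) (D X1 X2 q)
  rw [fderiv_eq_zero_of_eqOn_const hU h11 hq] at e111 e211
  rw [fderiv_eq_zero_of_eqOn_const hU h12 hq] at e112
  rw [fderiv_eq_zero_of_eqOn_const hU h22 hq] at e122
  simp only [hab, hab', hde, hg.add_left q hq, hg.add_right q hq, hg.smul_left q hq,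
    hg.smul_right q hq, h11 q hq, h12 q hq, h22 q hq, h21,
    zero_apply] at e111 e211 e112 e122
  rw [hc q hq, hde, hab'] at ht
  have t1 := congrArg (fun v => g q v (X1 q)) ht
  have t2 := congrArg (fun v => g q v (X2 q)) ht
  simp only [sub_eq_add_neg, ← neg_one_smul ℝ (a' • X1 q + b' • X2 q), hg.add_left q hq,
    hg.smul_left q hq, h11 q hq, h12 q hq, h22 q hq, h21] at t1 t2
  obtain rfl : a = 0 := by linarith
  obtain rfl : a' = 0 := by linarith
  obtain rfl : e = 0 := by linarith
  have hd : d = c1 q := by linarith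
  have hb : b = c1 q := by linarith
  have hb' : b' = -c2 q := by linarith
  simp [hab, hab', hde, hd, hb, hb']

end IsLeviCivita

theorem sectional_curvature_orthonormal_frame
    (U : Set Pt) (hU : IsOpen U)
    (X1 X2 : VF)
    (hX1 : ContDiffOn ℝ (⊤ : ℕ∞) X1 U) (hX2 : ContDiffOn ℝ (⊤ : ℕ∞) X2 U)
    (hbasis : ∀ q ∈ U, LinearIndependent ℝ ![X1 q, X2 q])
    (g : Pt → Pt → Pt → ℝ) (hg : SmoothSymmBilin U g)
    (h11 : ∀ q ∈ U, g q (X1 q) (X1 q) = -1)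
    (h22 : ∀ q ∈ U, g q (X2 q) (X2 q) = 1)
    (h12 : ∀ q ∈ U, g q (X1 q) (X2 q) = 0)
    (c1 c2 : Pt → ℝ)
    (hc1 : ContDiffOn ℝ (⊤ : ℕ∞) c1 U) (hc2 : ContDiffOn ℝ (⊤ : ℕ∞) c2 U)
    (hc : ∀ q ∈ U, vbracket X1 X2 q = c1 q • X1 q + c2 q • X2 q)
    (D : VF → VF → VF) (hD : IsLeviCivita U g D)
    (R : VF)
    (hR : ∀ q : Pt, R q =
      D (vbracket X1 X2) X1 q - D X1 (D X2 X1) q + D X2 (D X1 X1) q)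
    (K : Pt → ℝ)
    (hK : ∀ q ∈ U, K q = g q (R q) (X2 q) / (-1)) :
    ∀ q ∈ U, K q =
      -(c1 q) ^ 2 + (c2 q) ^ 2 - dirDeriv X2 c1 q - dirDeriv X1 c2 q := by
  intro q hq
  have hF {p : Pt} (hp : p ∈ U) :=
    hD.frame_eq hU hX1 hX2 hbasis hg h11 h22 h12 hc hp
  have h1 : D (vbracket X1 X2) X1 q = c1 q • D X1 X1 q + c2 q • D X2 X1 q := by
    have hs1 : ContDiffOn ℝ (⊤ : ℕ∞) (fun p => c1 p • X1 p) U := hc1.smul hX1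
    have hs2 : ContDiffOn ℝ (⊤ : ℕ∞) (fun p => c2 p • X2 p) U := hc2.smul hX2
    rw [hD.congr_fst (V' := (fun p => c1 p • X1 p) + fun p => c2 p • X2 p)
      ((hs1.add hs2).congr hc) (hs1.add hs2) hX1 hc hq, hD.add_fst _ _ _ hs1 hs2 hX1 q hq,
      hD.smul_fst _ _ _ hc1 hX1 hX1 q hq, hD.smul_fst _ _ _ hc2 hX2 hX1 q hq]
  have h2 : D X1 (D X2 X1) q = -fderiv ℝ c2 q (X1 q) • X2 q + -c2 q • D X1 X2 q := by
    rw [hD.congr_snd (W' := fun p => -c2 p • X2 p) hX1 (hD.smooth _ _ hX2 hX1)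
      (hc2.neg.smul hX2) (fun p hp => (hF hp).2.1) hq,
      hD.leibniz (fun p => -c2 p) X1 X2 hc2.neg hX1 hX2 q hq, fderiv_fun_neg]
    rfl
  have h3 : D X2 (D X1 X1) q = fderiv ℝ c1 q (X2 q) • X2 q + c1 q • D X2 X2 q := by
    rw [hD.congr_snd (W' := fun p => c1 p • X2 p) hX2 (hD.smooth _ _ hX1 hX1)
      (hc1.smul hX2) (fun p hp => (hF hp).1) hq, hD.leibniz c1 X2 X2 hc1 hX2 hX2 q hq]
  have h222 : g q (D X2 X2 q) (X2 q) = 0 := by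
    have h := hD.compat X2 X2 X2 hX2 hX2 hX2 q hq
    rw [fderiv_eq_zero_of_eqOn_const hU h22 hq, hg.symm q hq (X2 q),
      zero_apply] at h
    linarith
  obtain ⟨f11, f21, f12⟩ := hF hq
  rw [hK q hq, hR q, h1, h2, h3, f11, f21, f12, sub_eq_add_neg,
    ← neg_one_smul ℝ (-fderiv ℝ c2 q (X1 q) • X2 q + -c2 q • c1 q • X1 q)]
  simp only [hg.add_left q hq, hg.smul_left q hq, h12 q hq, h22 q hq, h222, dirDeriv]
  ring
end
end

section
/- Let D be a Levi-Civita connection for g. Then at every point of U, g(D_{X1}X1, X1) = 0 and g(D_{X1}X1, X2) = −A, where A = a11·c1 + a12·c2. -/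
noncomputable section

theorem fderiv_apply_eq_zero_of_eq_const {E : Type*} [NormedAddCommGroup E] [NormedSpace ℝ E]
    {U : Set E} (hU : IsOpen U) {f : E → ℝ} {a : ℝ} (hf : ∀ p ∈ U, f p = a) {q : E} (hq : q ∈ U)
    (v : E) : fderiv ℝ f q v = 0 := by
  have h : f =ᶠ[nhds q] fun _ => a := Filter.eventuallyEq_of_mem (hU.mem_nhds hq) hf
  simp [h.fderiv_eq]

theorem connection_coefficients_D_X1_X1
    (U : Set Pt) (hU : IsOpen U)
    (X1 X2 : VF)
    (hX1 : ContDiffOn ℝ (⊤ : ℕ∞) X1 U) (hX2 : ContDiffOn ℝ (⊤ : ℕ∞) X2 U)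
    (hbasis : ∀ q ∈ U, LinearIndependent ℝ ![X1 q, X2 q])
    (g : Pt → Pt → Pt → ℝ) (hg : SmoothSymmBilin U g)
    (a11 a12 a22 : ℝ)
    (h11 : ∀ q ∈ U, g q (X1 q) (X1 q) = a11)
    (h22 : ∀ q ∈ U, g q (X2 q) (X2 q) = a22)
    (h12 : ∀ q ∈ U, g q (X1 q) (X2 q) = a12)
    (hnd : a11 * a22 - a12 ^ 2 ≠ 0)
    (c1 c2 : Pt → ℝ)
    (hc1 : ContDiffOn ℝ (⊤ : ℕ∞) c1 U) (hc2 : ContDiffOn ℝ (⊤ : ℕ∞) c2 U)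
    (hc : ∀ q ∈ U, vbracket X1 X2 q = c1 q • X1 q + c2 q • X2 q)
    (D : VF → VF → VF) (hD : IsLeviCivita U g D)
    :
    ∀ q ∈ U, g q (D X1 X1 q) (X1 q) = 0 ∧
      g q (D X1 X1 q) (X2 q) = -(a11 * c1 q + a12 * c2 q) := by
  intro q hq
  have hX1X1 := hD.compat X1 X1 X1 hX1 hX1 hX1 q hq
  have hX2X1 := hD.compat X2 X1 X1 hX2 hX1 hX1 q hq
  have hX1X2 := hD.compat X1 X1 X2 hX1 hX1 hX2 q hq
  rw [fderiv_apply_eq_zero_of_eq_const hU h11 hq, hg.symm q hq (X1 q)] at hX1X1 hX2X1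
  rw [fderiv_apply_eq_zero_of_eq_const hU h12 hq] at hX1X2
  have htorsion : D X1 X2 q = c1 q • X1 q + c2 q • X2 q + D X2 X1 q := by
    rw [← hc q hq, ← hD.torsion_free X1 X2 hX1 hX2 q hq, sub_add_cancel]
  rw [htorsion, hg.add_right q hq, hg.add_right q hq, hg.smul_right q hq, hg.smul_right q hq,
    h11 q hq, h12 q hq, hg.symm q hq (X1 q) (D X2 X1 q)] at hX1X2
  constructor <;> linarith
end
end

section
/- Let D be a Levi-Civita connection for g. Then at every point of U, g(D_{X1}X2, X1) = A and g(D_{X1}X2, X2) = 0, where A = a11·c1 + a12·c2. -/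
noncomputable section

lemma IsLeviCivita.metric_self_eq_zero {U : Set Pt} (hU : IsOpen U) {g : Pt → Pt → Pt → ℝ}
    (hg : SmoothSymmBilin U g) {D : VF → VF → VF} (hD : IsLeviCivita U g D) {X V : VF}
    (hX : ContDiffOn ℝ (⊤ : ℕ∞) X U) (hV : ContDiffOn ℝ (⊤ : ℕ∞) V U) {a : ℝ}
    (ha : ∀ q ∈ U, g q (V q) (V q) = a) {q : Pt} (hq : q ∈ U) :
    g q (D X V q) (V q) = 0 := by
  have hconst : (fun p => g p (V p) (V p)) =ᶠ[nhds q] fun _ => a :=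
    Filter.eventually_of_mem (hU.mem_nhds hq) ha
  have h := hD.compat X V V hX hV hV q hq
  rw [hconst.fderiv_eq, fderiv_fun_const, hg.symm q hq (V q)] at h
  simp only [Pi.zero_apply, zero_apply] at h
  linarith

theorem connection_coefficients_D_X1_X2
    (U : Set Pt) (hU : IsOpen U)
    (X1 X2 : VF)
    (hX1 : ContDiffOn ℝ (⊤ : ℕ∞) X1 U) (hX2 : ContDiffOn ℝ (⊤ : ℕ∞) X2 U)
    (hbasis : ∀ q ∈ U, LinearIndependent ℝ ![X1 q, X2 q])
    (g : Pt → Pt → Pt → ℝ) (hg : SmoothSymmBilin U g)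
    (a11 a12 a22 : ℝ)
    (h11 : ∀ q ∈ U, g q (X1 q) (X1 q) = a11)
    (h22 : ∀ q ∈ U, g q (X2 q) (X2 q) = a22)
    (h12 : ∀ q ∈ U, g q (X1 q) (X2 q) = a12)
    (hnd : a11 * a22 - a12 ^ 2 ≠ 0)
    (c1 c2 : Pt → ℝ)
    (hc1 : ContDiffOn ℝ (⊤ : ℕ∞) c1 U) (hc2 : ContDiffOn ℝ (⊤ : ℕ∞) c2 U)
    (hc : ∀ q ∈ U, vbracket X1 X2 q = c1 q • X1 q + c2 q • X2 q)
    (D : VF → VF → VF) (hD : IsLeviCivita U g D)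
    :
    ∀ q ∈ U, g q (D X1 X2 q) (X1 q) = a11 * c1 q + a12 * c2 q ∧
      g q (D X1 X2 q) (X2 q) = 0 := by
  intro q hq
  refine ⟨?_, hD.metric_self_eq_zero hU hg hX1 hX2 h22 hq⟩
  have htor : D X1 X2 q = D X2 X1 q + (c1 q • X1 q + c2 q • X2 q) := by
    rw [← hc q hq, ← hD.torsion_free X1 X2 hX1 hX2 q hq, add_sub_cancel]
  rw [htor, hg.add_left q hq, hg.add_left q hq, hg.smul_left q hq, hg.smul_left q hq,
    hD.metric_self_eq_zero hU hg hX2 hX1 h11 hq, h11 q hq, hg.symm q hq (X2 q), h12 q hq]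
  ring
end
end

section
/- Let D be a Levi-Civita connection for g. Then at every point of U, g(D_{X2}X1, X1) = 0 and g(D_{X2}X1, X2) = −B, where B = a12·c1 + a22·c2. -/
noncomputable section

/-- If `g(W, W)` is constant on the open set `U`, then `D_V W` is `g`-orthogonal to `W`. -/
theorem IsLeviCivita.self_inner_eq_zero {U : Set Pt} {g : Pt → Pt → Pt → ℝ} {D : VF → VF → VF}
    (hD : IsLeviCivita U g D) (hg : SmoothSymmBilin U g) (hU : IsOpen U) {V W : VF}
    (hV : ContDiffOn ℝ (⊤ : ℕ∞) V U) (hW : ContDiffOn ℝ (⊤ : ℕ∞) W U) {a : ℝ}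
    (ha : ∀ q ∈ U, g q (W q) (W q) = a) {q : Pt} (hq : q ∈ U) :
    g q (D V W q) (W q) = 0 := by
  have hconst : (fun p => g p (W p) (W p)) =ᶠ[nhds q] fun _ => a :=
    Filter.eventually_of_mem (hU.mem_nhds hq) ha
  have h := hD.compat V W W hV hW hW q hq
  rw [hconst.fderiv_eq, fderiv_fun_const, hg.symm q hq (W q)] at h
  simp only [Pi.zero_apply, zero_apply] at h
  linarith

theorem connection_coefficients_D_X2_X1
    (U : Set Pt) (hU : IsOpen U)
    (X1 X2 : VF)
    (hX1 : ContDiffOn ℝ (⊤ : ℕ∞) X1 U) (hX2 : ContDiffOn ℝ (⊤ : ℕ∞) X2 U)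
    (hbasis : ∀ q ∈ U, LinearIndependent ℝ ![X1 q, X2 q])
    (g : Pt → Pt → Pt → ℝ) (hg : SmoothSymmBilin U g)
    (a11 a12 a22 : ℝ)
    (h11 : ∀ q ∈ U, g q (X1 q) (X1 q) = a11)
    (h22 : ∀ q ∈ U, g q (X2 q) (X2 q) = a22)
    (h12 : ∀ q ∈ U, g q (X1 q) (X2 q) = a12)
    (hnd : a11 * a22 - a12 ^ 2 ≠ 0)
    (c1 c2 : Pt → ℝ)
    (hc1 : ContDiffOn ℝ (⊤ : ℕ∞) c1 U) (hc2 : ContDiffOn ℝ (⊤ : ℕ∞) c2 U)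
    (hc : ∀ q ∈ U, vbracket X1 X2 q = c1 q • X1 q + c2 q • X2 q)
    (D : VF → VF → VF) (hD : IsLeviCivita U g D)
    :
    ∀ q ∈ U, g q (D X2 X1 q) (X1 q) = 0 ∧
      g q (D X2 X1 q) (X2 q) = -(a12 * c1 q + a22 * c2 q) := by
  intro q hq
  refine ⟨hD.self_inner_eq_zero hg hU hX2 hX1 h11 hq, ?_⟩
  have h := hD.self_inner_eq_zero hg hU hX1 hX2 h22 hq
  have ht := hD.torsion_free X1 X2 hX1 hX2 q hq
  rw [hc q hq, sub_eq_iff_eq_add] at ht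
  rw [ht, hg.add_left q hq, hg.add_left q hq, hg.smul_left q hq, hg.smul_left q hq,
    h12 q hq, h22 q hq] at h
  linarith
end
end

section
/- Let D be a Levi-Civita connection for g. Then at every point of U, D_{X2}X1 = (B/det𝒜)·(a12·X1 − a11·X2), where B = a12·c1 + a22·c2 and det𝒜 = a11·a22 − a12². -/
noncomputable section

/-- A vector is determined by its products with a basis whose Gram matrix is nondegenerate. -/
theorem SmoothSymmBilin.eq_of_apply_eq {U : Set Pt} {g : Pt → Pt → Pt → ℝ}
    (hg : SmoothSymmBilin U g) {q : Pt} (hq : q ∈ U) {e₁ e₂ : Pt}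
    (he : LinearIndependent ℝ ![e₁, e₂])
    (hnd : g q e₁ e₁ * g q e₂ e₂ - g q e₁ e₂ ^ 2 ≠ 0) {v : Pt} {B : ℝ}
    (h₁ : g q v e₁ = 0) (h₂ : g q v e₂ = -B) :
    v = (B / (g q e₁ e₁ * g q e₂ e₂ - g q e₁ e₂ ^ 2)) • (g q e₁ e₂ • e₁ - g q e₁ e₁ • e₂) := by
  have hspan : v ∈ Submodule.span ℝ (Set.range ![e₁, e₂]) := by
    rw [he.span_eq_top_of_card_eq_finrank' (by simp)]
    trivial
  rw [Matrix.range_cons_cons_empty, Submodule.mem_span_pair] at hspan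
  obtain ⟨x, y, rfl⟩ := hspan
  simp only [hg.add_left q hq, hg.smul_left q hq, hg.symm q hq e₂ e₁] at h₁ h₂
  have hx : x = B / (g q e₁ e₁ * g q e₂ e₂ - g q e₁ e₂ ^ 2) * g q e₁ e₂ := by
    field_simp
    linear_combination g q e₂ e₂ * h₁ - g q e₁ e₂ * h₂
  have hy : y = -(B / (g q e₁ e₁ * g q e₂ e₂ - g q e₁ e₂ ^ 2) * g q e₁ e₁) := by
    field_simp
    linear_combination g q e₁ e₁ * h₂ - g q e₁ e₂ * h₁
  rw [hx, hy]
  module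

/-- If `g(W, W)` is constant on the open set `U`, then `D_V W` is orthogonal to `W`. -/
theorem IsLeviCivita.apply_self_eq_zero {U : Set Pt} (hU : IsOpen U) {g : Pt → Pt → Pt → ℝ}
    (hg : SmoothSymmBilin U g) {D : VF → VF → VF} (hD : IsLeviCivita U g D) {V W : VF}
    (hV : ContDiffOn ℝ (⊤ : ℕ∞) V U) (hW : ContDiffOn ℝ (⊤ : ℕ∞) W U) {a : ℝ}
    (hconst : ∀ q ∈ U, g q (W q) (W q) = a) {q : Pt} (hq : q ∈ U) :
    g q (D V W q) (W q) = 0 := by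
  have hc := hD.compat V W W hV hW hW q hq
  have heq : (fun p => g p (W p) (W p)) =ᶠ[nhds q] fun _ => a :=
    Filter.eventually_of_mem (hU.mem_nhds hq) hconst
  rw [heq.fderiv_eq, fderiv_const_apply, zero_apply,
    hg.symm q hq (W q)] at hc
  linarith

theorem covariant_derivative_D_X2_X1
    (U : Set Pt) (hU : IsOpen U)
    (X1 X2 : VF)
    (hX1 : ContDiffOn ℝ (⊤ : ℕ∞) X1 U) (hX2 : ContDiffOn ℝ (⊤ : ℕ∞) X2 U)
    (hbasis : ∀ q ∈ U, LinearIndependent ℝ ![X1 q, X2 q])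
    (g : Pt → Pt → Pt → ℝ) (hg : SmoothSymmBilin U g)
    (a11 a12 a22 : ℝ)
    (h11 : ∀ q ∈ U, g q (X1 q) (X1 q) = a11)
    (h22 : ∀ q ∈ U, g q (X2 q) (X2 q) = a22)
    (h12 : ∀ q ∈ U, g q (X1 q) (X2 q) = a12)
    (hnd : a11 * a22 - a12 ^ 2 ≠ 0)
    (c1 c2 : Pt → ℝ)
    (hc1 : ContDiffOn ℝ (⊤ : ℕ∞) c1 U) (hc2 : ContDiffOn ℝ (⊤ : ℕ∞) c2 U)
    (hc : ∀ q ∈ U, vbracket X1 X2 q = c1 q • X1 q + c2 q • X2 q)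
    (D : VF → VF → VF) (hD : IsLeviCivita U g D)
    :
    ∀ q ∈ U, D X2 X1 q = ((a12 * c1 q + a22 * c2 q) / (a11 * a22 - a12 ^ 2)) • (a12 • X1 q - a11 • X2 q) := by
  intro q hq
  have hT : D X1 X2 q = D X2 X1 q + (c1 q • X1 q + c2 q • X2 q) := by
    rw [← hc q hq, ← hD.torsion_free X1 X2 hX1 hX2 q hq]
    abel
  have h₁ := hD.apply_self_eq_zero hU hg hX2 hX1 h11 hq
  have h₂ := hD.apply_self_eq_zero hU hg hX1 hX2 h22 hq
  rw [hT] at h₂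
  simp only [hg.add_left q hq, hg.smul_left q hq, h12 q hq, h22 q hq] at h₂
  have key := hg.eq_of_apply_eq hq (hbasis q hq) (by rwa [h11 q hq, h22 q hq, h12 q hq]) h₁
    (B := a12 * c1 q + a22 * c2 q) (by linarith)
  rwa [h11 q hq, h22 q hq, h12 q hq] at key
end
end

section
/- Let D be a Levi-Civita connection for g. Then at every point of U, D_{X2}X2 = (B/det𝒜)·(a22·X1 − a12·X2), where B = a12·c1 + a22·c2 and det𝒜 = a11·a22 − a12². -/
noncomputable section

/-- If `g (V, W)` is constant, the two terms of the metric-compatibility identity cancel. -/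
theorem IsLeviCivita.add_eq_zero_of_const {U : Set Pt} {g : Pt → Pt → Pt → ℝ} {D : VF → VF → VF}
    (hD : IsLeviCivita U g D) (hU : IsOpen U) {X V W : VF}
    (hX : ContDiffOn ℝ (⊤ : ℕ∞) X U) (hV : ContDiffOn ℝ (⊤ : ℕ∞) V U)
    (hW : ContDiffOn ℝ (⊤ : ℕ∞) W U) {a : ℝ} (ha : ∀ q ∈ U, g q (V q) (W q) = a)
    {q : Pt} (hq : q ∈ U) :
    g q (D X V q) (W q) + g q (V q) (D X W q) = 0 := by
  have hconst : (fun p => g p (V p) (W p)) =ᶠ[nhds q] fun _ => a :=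
    Filter.eventually_of_mem (hU.mem_nhds hq) ha
  rw [← hD.compat X V W hX hV hW q hq, hconst.fderiv_eq]
  simp

theorem exists_smul_add_smul_eq {v w : Pt} (h : LinearIndependent ℝ ![v, w]) (u : Pt) :
    ∃ x y : ℝ, x • v + y • w = u := by
  have hspan := h.span_eq_top_of_card_eq_finrank (by simp)
  rw [Matrix.range_cons_cons_empty] at hspan
  exact Submodule.mem_span_pair.mp (hspan ▸ Submodule.mem_top)

theorem covariant_derivative_D_X2_X2
    (U : Set Pt) (hU : IsOpen U)
    (X1 X2 : VF)
    (hX1 : ContDiffOn ℝ (⊤ : ℕ∞) X1 U) (hX2 : ContDiffOn ℝ (⊤ : ℕ∞) X2 U)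
    (hbasis : ∀ q ∈ U, LinearIndependent ℝ ![X1 q, X2 q])
    (g : Pt → Pt → Pt → ℝ) (hg : SmoothSymmBilin U g)
    (a11 a12 a22 : ℝ)
    (h11 : ∀ q ∈ U, g q (X1 q) (X1 q) = a11)
    (h22 : ∀ q ∈ U, g q (X2 q) (X2 q) = a22)
    (h12 : ∀ q ∈ U, g q (X1 q) (X2 q) = a12)
    (hnd : a11 * a22 - a12 ^ 2 ≠ 0)
    (c1 c2 : Pt → ℝ)
    (hc1 : ContDiffOn ℝ (⊤ : ℕ∞) c1 U) (hc2 : ContDiffOn ℝ (⊤ : ℕ∞) c2 U)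
    (hc : ∀ q ∈ U, vbracket X1 X2 q = c1 q • X1 q + c2 q • X2 q)
    (D : VF → VF → VF) (hD : IsLeviCivita U g D)
    :
    ∀ q ∈ U, D X2 X2 q = ((a12 * c1 q + a22 * c2 q) / (a11 * a22 - a12 ^ 2)) • (a22 • X1 q - a12 • X2 q) := by
  intro q hq
  have hort2 := hD.add_eq_zero_of_const hU hX2 hX2 hX2 h22 hq
  have hort1 := hD.add_eq_zero_of_const hU hX1 hX2 hX2 h22 hq
  have hmix := hD.add_eq_zero_of_const hU hX2 hX1 hX2 h12 hq
  have htor : D X1 X2 q = D X2 X1 q + (c1 q • X1 q + c2 q • X2 q) := by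
    rw [← hc q hq, ← hD.torsion_free X1 X2 hX1 hX2 q hq]
    abel
  rw [hg.symm q hq (X2 q), htor] at hort1
  rw [hg.symm q hq (X2 q)] at hort2
  obtain ⟨x, y, hxy⟩ := exists_smul_add_smul_eq (hbasis q hq) (D X2 X2 q)
  rw [← hxy] at hmix hort2 ⊢
  simp only [hg.add_left q hq, hg.add_right q hq, hg.smul_left q hq, hg.smul_right q hq,
    h11 q hq, h12 q hq, h22 q hq] at hort1 hort2 hmix
  have hx : x = (a12 * c1 q + a22 * c2 q) / (a11 * a22 - a12 ^ 2) * a22 := by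
    rw [div_mul_eq_mul_div, eq_div_iff hnd]
    linear_combination a22 * hmix - a22 / 2 * hort1 - a12 / 2 * hort2
  have hy : y = -((a12 * c1 q + a22 * c2 q) / (a11 * a22 - a12 ^ 2) * a12) := by
    rw [div_mul_eq_mul_div, ← neg_div, eq_div_iff hnd]
    linear_combination a11 / 2 * hort2 - a12 * hmix + a12 / 2 * hort1
  rw [hx, hy]
  module
end
end

section
/- Let X1, X2 be smooth vector fields on an open set U ⊆ ℝ² with [X1, X2] = −X1 at every point, let α, β, γ, δ be real constants with αδ − βγ ≠ 0, and set Y1 = α·X1 + γ·X2, Y2 = β·X1 + δ·X2, assumed to form a basis of ℝ² at each point of U. Let g be a smooth assignment of symmetric bilinear forms with g(Y1,Y1) = −1, g(Y2,Y2) = 1, g(Y1,Y2) = 0 everywhere, and let D be a Levi-Civita connection for g, with R_{XY}Z = D_{[X,Y]}Z − D_X D_Y Z + D_Y D_X Z. Then the sectional curvature K = g(R_{Y1 Y2}Y1, Y2)/(−1) is identically equal to γ² − δ². -/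
noncomputable section

open Classical in
/-- A connection is local in its second argument. -/
theorem IsLeviCivita.congr_snd_s15 {U : Set Pt} {g : Pt → Pt → Pt → ℝ} {D : VF → VF → VF}
    (hD : IsLeviCivita U g D) {V W W' : VF} (hV : ContDiffOn ℝ (⊤ : ℕ∞) V U)
    (hW : ContDiffOn ℝ (⊤ : ℕ∞) W U) (hW' : ContDiffOn ℝ (⊤ : ℕ∞) W' U)
    (h : ∀ q ∈ U, W q = W' q) {q : Pt} (hq : q ∈ U) : D V W q = D V W' q := by
  have hZ : ContDiffOn ℝ (⊤ : ℕ∞) (W - W') U := hW.sub hW'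
  let f : Pt → ℝ := fun p => if p ∈ U then 0 else 1
  have hf : ContDiffOn ℝ (⊤ : ℕ∞) f U :=
    (contDiffOn_const (c := (0 : ℝ))).congr fun p hp => if_pos hp
  have hfZ : (fun p => f p • (W - W') p) = W - W' := by
    funext p
    by_cases hp : p ∈ U <;> simp [f, hp, h]
  have hzero : D V (W - W') q = 0 := by
    have := hD.leibniz f V (W - W') hf hV hZ q hq
    rw [hfZ] at this
    rw [this]
    simp [f, hq, h]
  have hadd := hD.add_snd V W' (W - W') hV hW' hZ q hq
  rwa [add_sub_cancel, hzero, add_zero] at hadd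

open Classical in
/-- A connection is local in its first argument. -/
theorem IsLeviCivita.congr_fst_s15 {U : Set Pt} {g : Pt → Pt → Pt → ℝ} {D : VF → VF → VF}
    (hD : IsLeviCivita U g D) {V V' W : VF} (hV : ContDiffOn ℝ (⊤ : ℕ∞) V U)
    (hV' : ContDiffOn ℝ (⊤ : ℕ∞) V' U) (hW : ContDiffOn ℝ (⊤ : ℕ∞) W U)
    (h : ∀ q ∈ U, V q = V' q) {q : Pt} (hq : q ∈ U) : D V W q = D V' W q := by
  have hZ : ContDiffOn ℝ (⊤ : ℕ∞) (V - V') U := hV.sub hV'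
  let f : Pt → ℝ := fun p => if p ∈ U then 0 else 1
  have hf : ContDiffOn ℝ (⊤ : ℕ∞) f U :=
    (contDiffOn_const (c := (0 : ℝ))).congr fun p hp => if_pos hp
  have hfZ : (fun p => f p • (V - V') p) = V - V' := by
    funext p
    by_cases hp : p ∈ U <;> simp [f, hp, h]
  have hzero : D (V - V') W q = 0 := by
    have := hD.smul_fst f (V - V') W hf hZ hW q hq
    rw [hfZ] at this
    rw [this]
    simp [f, hq]
  have hadd := hD.add_fst V' (V - V') W hV' hZ hW q hq
  rwa [add_sub_cancel, hzero, add_zero] at hadd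

theorem IsLeviCivita.const_smul_fst {U : Set Pt} {g : Pt → Pt → Pt → ℝ} {D : VF → VF → VF}
    (hD : IsLeviCivita U g D) (r : ℝ) {V W : VF} (hV : ContDiffOn ℝ (⊤ : ℕ∞) V U)
    (hW : ContDiffOn ℝ (⊤ : ℕ∞) W U) {q : Pt} (hq : q ∈ U) :
    D (r • V) W q = r • D V W q :=
  hD.smul_fst (fun _ => r) V W contDiffOn_const hV hW q hq

/-- Metric compatibility for two fields whose inner product is constant on `U`. -/
theorem IsLeviCivita.compat_of_const {U : Set Pt} {g : Pt → Pt → Pt → ℝ} {D : VF → VF → VF}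
    (hD : IsLeviCivita U g D) (hU : IsOpen U) {X V W : VF} (hX : ContDiffOn ℝ (⊤ : ℕ∞) X U)
    (hV : ContDiffOn ℝ (⊤ : ℕ∞) V U) (hW : ContDiffOn ℝ (⊤ : ℕ∞) W U) {c : ℝ}
    (h : ∀ q ∈ U, g q (V q) (W q) = c) {q : Pt} (hq : q ∈ U) :
    g q (D X V q) (W q) + g q (V q) (D X W q) = 0 := by
  have heq : (fun p => g p (V p) (W p)) =ᶠ[nhds q] fun _ => c :=
    Filter.eventually_of_mem (hU.mem_nhds hq) h
  rw [← hD.compat X V W hX hV hW q hq, heq.fderiv_eq]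
  simp

/-- A vector is determined by its inner products with a Lorentzian orthonormal basis. -/
theorem SmoothSymmBilin.eq_orthonormal_expansion {U : Set Pt} {g : Pt → Pt → Pt → ℝ}
    (hg : SmoothSymmBilin U g) {q : Pt} (hq : q ∈ U) {e₁ e₂ : Pt}
    (hb : LinearIndependent ℝ ![e₁, e₂]) (h11 : g q e₁ e₁ = -1) (h22 : g q e₂ e₂ = 1)
    (h12 : g q e₁ e₂ = 0) (v : Pt) : v = (-g q v e₁) • e₁ + g q v e₂ • e₂ := by
  have hspan : v ∈ Submodule.span ℝ {e₁, e₂} := by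
    have := hb.span_eq_top_of_card_eq_finrank (by simp)
    rw [Matrix.range_cons, Matrix.range_cons, Matrix.range_empty, Set.union_empty,
      Set.singleton_union] at this
    rw [this]
    trivial
  obtain ⟨x, y, rfl⟩ := Submodule.mem_span_pair.mp hspan
  simp only [hg.add_left q hq, hg.smul_left q hq, h11, h22, h12, hg.symm q hq e₂ e₁]
  simp

/-- The bracket of constant-coefficient combinations of two fields. -/
theorem vbracket_linear_combination {X₁ X₂ : VF} {q : Pt} (h₁ : DifferentiableAt ℝ X₁ q)
    (h₂ : DifferentiableAt ℝ X₂ q) (a b c d : ℝ) :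
    vbracket (fun p => a • X₁ p + c • X₂ p) (fun p => b • X₁ p + d • X₂ p) q =
      (a * d - b * c) • vbracket X₁ X₂ q := by
  have hf : ∀ r s : ℝ, fderiv ℝ (fun p => r • X₁ p + s • X₂ p) q =
      r • fderiv ℝ X₁ q + s • fderiv ℝ X₂ q := fun r s =>
    ((h₁.hasFDerivAt.const_smul r).add (h₂.hasFDerivAt.const_smul s)).fderiv
  simp only [vbracket, hf, add_apply, smul_apply, map_add,
    map_smul]
  module

theorem sectional_curvature_transformed_frame
    (U : Set Pt) (hU : IsOpen U)
    (X1 X2 : VF)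
    (hX1 : ContDiffOn ℝ (⊤ : ℕ∞) X1 U) (hX2 : ContDiffOn ℝ (⊤ : ℕ∞) X2 U)
    (hbr : ∀ q ∈ U, vbracket X1 X2 q = -X1 q)
    (α β γ δ : ℝ) (hdet : α * δ - β * γ ≠ 0)
    (Y1 Y2 : VF)
    (hY1 : ∀ q : Pt, Y1 q = α • X1 q + γ • X2 q)
    (hY2 : ∀ q : Pt, Y2 q = β • X1 q + δ • X2 q)
    (hbasis : ∀ q ∈ U, LinearIndependent ℝ ![Y1 q, Y2 q])
    (g : Pt → Pt → Pt → ℝ) (hg : SmoothSymmBilin U g)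
    (h11 : ∀ q ∈ U, g q (Y1 q) (Y1 q) = -1)
    (h22 : ∀ q ∈ U, g q (Y2 q) (Y2 q) = 1)
    (h12 : ∀ q ∈ U, g q (Y1 q) (Y2 q) = 0)
    (D : VF → VF → VF) (hD : IsLeviCivita U g D)
    (R : VF)
    (hR : ∀ q : Pt, R q =
      D (vbracket Y1 Y2) Y1 q - D Y1 (D Y2 Y1) q + D Y2 (D Y1 Y1) q)
    (K : Pt → ℝ)
    (hK : ∀ q ∈ U, K q = g q (R q) (Y2 q) / (-1)) :
    ∀ q ∈ U, K q = γ ^ 2 - δ ^ 2 := by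
  intro q hq
  have hY1s : ContDiffOn ℝ (⊤ : ℕ∞) Y1 U :=
    ((hX1.const_smul α).add (hX2.const_smul γ)).congr fun p _ => hY1 p
  have hY2s : ContDiffOn ℝ (⊤ : ℕ∞) Y2 U :=
    ((hX1.const_smul β).add (hX2.const_smul δ)).congr fun p _ => hY2 p
  have hB : ∀ p ∈ U, vbracket Y1 Y2 p = ((-δ) • Y1 + γ • Y2) p := by
    intro p hp
    have hd : ∀ X : VF, ContDiffOn ℝ (⊤ : ℕ∞) X U → DifferentiableAt ℝ X p := fun X hX =>
      (hX.differentiableOn (by simp)).differentiableAt (hU.mem_nhds hp)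
    rw [funext hY1, funext hY2, vbracket_linear_combination (hd X1 hX1) (hd X2 hX2), hbr p hp]
    simp only [Pi.add_apply, Pi.smul_apply]
    module
  have hBs : ContDiffOn ℝ (⊤ : ℕ∞) ((-δ) • Y1 + γ • Y2) U :=
    (hY1s.const_smul (-δ)).add (hY2s.const_smul γ)
  have hexp : ∀ p ∈ U, ∀ v : Pt, v = (-g p v (Y1 p)) • Y1 p + g p v (Y2 p) • Y2 p :=
    fun p hp => hg.eq_orthonormal_expansion hp (hbasis p hp) (h11 p hp) (h22 p hp) (h12 p hp)
  have hself : ∀ X V : VF, ContDiffOn ℝ (⊤ : ℕ∞) X U → ContDiffOn ℝ (⊤ : ℕ∞) V U →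
      ∀ c : ℝ, (∀ p ∈ U, g p (V p) (V p) = c) → ∀ p ∈ U, g p (D X V p) (V p) = 0 := by
    intro X V hX hV c hc p hp
    have := hD.compat_of_const hU hX hV hV hc hp
    rw [hg.symm p hp (V p)] at this
    linarith
  have hskew : ∀ X : VF, ContDiffOn ℝ (⊤ : ℕ∞) X U → ∀ p ∈ U,
      g p (D X Y1 p) (Y2 p) = -g p (D X Y2 p) (Y1 p) := by
    intro X hX p hp
    have := hD.compat_of_const hU hX hY1s hY2s h12 hp
    rw [hg.symm p hp (Y1 p)] at this
    linarith
  have htor : ∀ p ∈ U, D Y1 Y2 p = D Y2 Y1 p + ((-δ) • Y1 p + γ • Y2 p) := by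
    intro p hp
    rw [← sub_eq_iff_eq_add', hD.torsion_free Y1 Y2 hY1s hY2s p hp, hB p hp]
    rfl
  have hg_D12_Y1 : ∀ p ∈ U, g p (D Y1 Y2 p) (Y1 p) = δ := by
    intro p hp
    rw [htor p hp]
    simp only [hg.add_left p hp, hg.smul_left p hp, hself Y2 Y1 hY2s hY1s _ h11 p hp, h11 p hp,
      hg.symm p hp (Y2 p) (Y1 p), h12 p hp]
    ring
  have hg_D21_Y2 : ∀ p ∈ U, g p (D Y2 Y1 p) (Y2 p) = -γ := by
    intro p hp
    have h := hself Y1 Y2 hY1s hY2s _ h22 p hp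
    rw [htor p hp] at h
    simp only [hg.add_left p hp, hg.smul_left p hp, h22 p hp, h12 p hp] at h
    linarith
  have hD11 : ∀ p ∈ U, D Y1 Y1 p = ((-δ) • Y2) p := by
    intro p hp
    rw [hexp p hp (D Y1 Y1 p), hself Y1 Y1 hY1s hY1s _ h11 p hp, hskew Y1 hY1s p hp, hg_D12_Y1 p hp]
    simp
  have hD21 : ∀ p ∈ U, D Y2 Y1 p = ((-γ) • Y2) p := by
    intro p hp
    rw [hexp p hp (D Y2 Y1 p), hself Y2 Y1 hY2s hY1s _ h11 p hp, hg_D21_Y2 p hp]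
    simp
  have hRq : R q = ((-δ) • D Y1 Y1 q + γ • D Y2 Y1 q) + γ • D Y1 Y2 q + (-δ) • D Y2 Y2 q := by
    rw [hR q, hD.congr_fst_s15 (hBs.congr hB) hBs hY1s hB hq,
      hD.add_fst ((-δ) • Y1) (γ • Y2) Y1 (hY1s.const_smul (-δ)) (hY2s.const_smul γ) hY1s q hq,
      hD.const_smul_fst _ hY1s hY1s hq, hD.const_smul_fst _ hY2s hY1s hq,
      hD.congr_snd_s15 (W' := (-γ) • Y2) hY1s (hD.smooth _ _ hY2s hY1s) (hY2s.const_smul (-γ))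
        hD21 hq,
      hD.congr_snd_s15 (W' := (-δ) • Y2) hY2s (hD.smooth _ _ hY1s hY1s) (hY2s.const_smul (-δ))
        hD11 hq,
      hD.smul_snd _ _ _ hY1s hY2s q hq, hD.smul_snd _ _ _ hY2s hY2s q hq]
    module
  rw [hK q hq, hRq]
  simp only [hg.add_left q hq, hg.smul_left q hq, hskew Y1 hY1s q hq, hg_D12_Y1 q hq,
    hg_D21_Y2 q hq, hself Y1 Y2 hY1s hY2s _ h22 q hq,
    hself Y2 Y2 hY2s hY2s _ h22 q hq]
  ring
end
end
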